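/- arXiv:1412.5912 — 3 statements merged into one kernel-verified Lean document; each statement's English description precedes it below -/
import Mathlib

section
/- Let R be a commutative Noetherian local ring of dimension one and depth zero with maximal ideal 𝔪, n a positive integer such that 𝔪^n ∩ Γ_𝔪(R) = (0), a ∈ 𝔪^n a parameter of R, and c ∈ R such that b := c a^2 is a parameter of R. Then ((b) : a) = (c a) + Γ_𝔪(R) and (c a^2) = (c a) ∩ (Γ_𝔪(R) + (c a^2)); consequently Hom_R(R/(a), R/(b)) ≅ (c a)/(c a^2) ⊕ (Γ_𝔪(R) + (c a^2))/(c a^2) as R/(a)-modules, with both summands nonzero and with (c a)/(c a^2) not free over R/(a). -/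
/-- The `I`-power-torsion submodule `Γ_I(M) = {x ∈ M | I^k x = 0 for some k}`,
i.e. the zeroth local cohomology of `M` with support in `I`. -/
def torsionGamma {R : Type*} [CommRing R] (I : Ideal R) (M : Type*) [AddCommGroup M]
    [Module R M] : Submodule R M where
  carrier := {x | ∃ k : ℕ, ∀ r ∈ I ^ k, r • x = (0 : M)}
  zero_mem' := ⟨0, fun r _ => smul_zero r⟩
  add_mem' := by
    rintro x y ⟨k, hk⟩ ⟨l, hl⟩
    refine ⟨k + l, fun r hr => ?_⟩
    have hrk : r ∈ I ^ k := Ideal.pow_le_pow_right (Nat.le_add_right k l) hr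
    have hrl : r ∈ I ^ l := Ideal.pow_le_pow_right (Nat.le_add_left l k) hr
    rw [smul_add, hk r hrk, hl r hrl, add_zero]
  smul_mem' := by
    rintro c x ⟨k, hk⟩
    refine ⟨k, fun r hr => ?_⟩
    rw [smul_smul, mul_comm, ← smul_smul, hk r hr, smul_zero]

/-- The depth of a module: the supremum of the lengths of regular sequences on `M`
consisting of nonunits (for a local ring, elements of the maximal ideal). -/
noncomputable def moduleDepth (R M : Type*) [CommRing R] [AddCommGroup M] [Module R M] : ℕ∞ :=
  sSup {n : ℕ∞ | ∃ rs : List R, (rs.length : ℕ∞) = n ∧ (∀ r ∈ rs, r ∈ nonunits R) ∧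
    RingTheory.Sequence.IsRegular M rs}

/-- The (Krull) dimension of a module: the Krull dimension of `R / ann M`. -/
noncomputable def moduleDim (R M : Type*) [CommRing R] [AddCommGroup M] [Module R M] :
    WithBot ℕ∞ :=
  ringKrullDim (R ⧸ Module.annihilator R M)

/-- A module is Cohen-Macaulay if its depth equals its dimension. -/
def IsCohenMacaulay (R M : Type*) [CommRing R] [AddCommGroup M] [Module R M] : Prop :=
  (moduleDepth R M : WithBot ℕ∞) = moduleDim R M

/-- `a : Fin d → R` is a system of parameters of `M` if `M` has dimension `d`, the `a i`
are nonunits (i.e. lie in the maximal ideal, when `R` is local), and `M/(a)M` has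
finite length. -/
def IsSystemOfParameters (R M : Type*) [CommRing R] [AddCommGroup M] [Module R M]
    {d : ℕ} (a : Fin d → R) : Prop :=
  (∀ i, a i ∈ nonunits R) ∧ moduleDim R M = (d : ℕ∞) ∧
    IsFiniteLength R (M ⧸ (Ideal.span (Set.range a) • (⊤ : Submodule R M)))

/-- An ideal is a parameter ideal of `M` if it is generated by a system of parameters of `M`. -/
def IsParameterIdeal (R M : Type*) [CommRing R] [AddCommGroup M] [Module R M]
    (I : Ideal R) : Prop :=
  ∃ (d : ℕ) (a : Fin d → R), IsSystemOfParameters R M a ∧ I = Ideal.span (Set.range a)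

/-- A parameter of a one-dimensional module `M`: a nonunit `a` (i.e. an element of the
maximal ideal, when `R` is local) such that `M/aM` has finite length. -/
def IsParameter (R M : Type*) [CommRing R] [AddCommGroup M] [Module R M] (a : R) : Prop :=
  a ∈ nonunits R ∧ IsFiniteLength R (M ⧸ (Ideal.span {a} • (⊤ : Submodule R M)))

/-- A module is decomposable if it is the (internal, equivalently external) direct sum of
two nonzero submodules. -/
def IsDecomposable (R M : Type*) [Ring R] [AddCommGroup M] [Module R M] : Prop :=
  ∃ X Y : Submodule R M, X ≠ ⊥ ∧ Y ≠ ⊥ ∧ IsCompl X Y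

theorem homIsTorsion {R : Type*} [CommRing R] (I : Ideal R) (N : Type*) [AddCommGroup N]
    [Module R N] : Module.IsTorsionBySet R ((R ⧸ I) →ₗ[R] N) I := by
  intro φ a
  refine LinearMap.ext fun x => ?_
  obtain ⟨r, rfl⟩ := Ideal.Quotient.mk_surjective x
  have hx : (a : R) • (Ideal.Quotient.mk I r : R ⧸ I) = 0 := by
    have h1 : (a : R) • (Ideal.Quotient.mk I r : R ⧸ I) = Ideal.Quotient.mk I ((a : R) * r) :=
      rfl
    rw [h1, Ideal.Quotient.eq_zero_iff_mem]
    exact I.mul_mem_right r a.2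
  calc ((a : R) • φ) (Ideal.Quotient.mk I r)
      = (a : R) • φ (Ideal.Quotient.mk I r) := rfl
    _ = φ ((a : R) • (Ideal.Quotient.mk I r : R ⧸ I)) := (map_smul φ _ _).symm
    _ = 0 := by rw [hx, map_zero]

/-- The canonical `R ⧸ I`-module structure on `Hom_R(R ⧸ I, N)`. -/
noncomputable def quotHomModule {R : Type*} [CommRing R] (I : Ideal R) (N : Type*)
    [AddCommGroup N] [Module R N] : Module (R ⧸ I) ((R ⧸ I) →ₗ[R] N) :=
  (homIsTorsion I N).module

open IsLocalRing

theorem aux_pow_le {R : Type*} [CommRing R] [IsLocalRing R] (x : R) (hx : IsParameter R R x) :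
    ∃ k : ℕ, maximalIdeal R ^ k ≤ Ideal.span {x} := by
  have h := hx.2
  have e : (Ideal.span {x} • (⊤ : Submodule R R)) = Ideal.span {x} := by
    rw [smul_eq_mul, Ideal.mul_top]
  rw [e] at h
  have h1 : IsArtinian R (R ⧸ Ideal.span {x}) :=
    (isFiniteLength_iff_isNoetherian_isArtinian.mp h).2
  have h2 : IsArtinianRing (R ⧸ Ideal.span {x}) := isArtinian_of_tower R h1
  exact exists_maximalIdeal_pow_le_of_isArtinianRing_quotient _

theorem aux_iso {R : Type*} [CommRing R] (a : R) (B I J : Ideal R) (hI : B ≤ I) (hJ : B ≤ J)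
    (hIJ : I ⊓ J ≤ B) (hcol : ∀ r : R, r * a ∈ B ↔ r ∈ I ⊔ J) :
    Nonempty (((R ⧸ Ideal.span {a}) →ₗ[R] (R ⧸ B)) ≃ₗ[R]
      ((↥I ⧸ Submodule.comap I.subtype B) × (↥J ⧸ Submodule.comap J.subtype B))) := by
  let f1 : (↥I ⧸ Submodule.comap I.subtype B) →ₗ[R] (R ⧸ B) :=
    Submodule.mapQ _ _ I.subtype le_rfl
  let f2 : (↥J ⧸ Submodule.comap J.subtype B) →ₗ[R] (R ⧸ B) :=
    Submodule.mapQ _ _ J.subtype le_rfl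
  let F := f1.coprod f2
  let ev : ((R ⧸ Ideal.span {a}) →ₗ[R] (R ⧸ B)) →ₗ[R] (R ⧸ B) :=
    LinearMap.applyₗ (1 : R ⧸ Ideal.span {a})
  have hF : Function.Injective F := by
    rw [← LinearMap.ker_eq_bot, LinearMap.ker_eq_bot']
    rintro ⟨x, y⟩ h
    obtain ⟨⟨x, hx⟩, rfl⟩ := Submodule.Quotient.mk_surjective _ x
    obtain ⟨⟨y, hy⟩, rfl⟩ := Submodule.Quotient.mk_surjective _ y
    have h' : (Submodule.Quotient.mk (x + y) : R ⧸ B) = 0 := h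
    rw [Submodule.Quotient.mk_eq_zero] at h'
    have hxJ : x ∈ J := by simpa using J.sub_mem (hJ h') hy
    have hyI : y ∈ I := by simpa using I.sub_mem (hI h') hx
    ext1
    · exact (Submodule.Quotient.mk_eq_zero _).mpr (hIJ ⟨hx, hxJ⟩)
    · exact (Submodule.Quotient.mk_eq_zero _).mpr (hIJ ⟨hyI, hy⟩)
  have hev : Function.Injective ev := by
    intro φ ψ h
    have h' : φ 1 = ψ 1 := h
    ext
    exact h'
  have hr : LinearMap.range ev = LinearMap.range F := by
    apply le_antisymm
    · rintro _ ⟨φ, rfl⟩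
      obtain ⟨r, hr⟩ := Submodule.Quotient.mk_surjective _ (φ 1)
      have h1 : (Submodule.Quotient.mk (a * r) : R ⧸ B) = 0 := by
        have : (Submodule.Quotient.mk (a * r) : R ⧸ B) = a • Submodule.Quotient.mk r := rfl
        rw [this, hr, ← map_smul]
        have : a • (1 : R ⧸ Ideal.span {a}) = 0 := by
          have : a • (1 : R ⧸ Ideal.span {a}) = Ideal.Quotient.mk _ (a * 1) := rfl
          rw [this, Ideal.Quotient.eq_zero_iff_mem, mul_one]
          exact Ideal.mem_span_singleton_self a
        rw [this, map_zero]
      rw [Submodule.Quotient.mk_eq_zero, mul_comm, hcol] at h1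
      obtain ⟨x, hx, y, hy, rfl⟩ := Submodule.mem_sup.mp h1
      exact ⟨(Submodule.Quotient.mk ⟨x, hx⟩, Submodule.Quotient.mk ⟨y, hy⟩), hr⟩
    · rintro _ ⟨⟨x, y⟩, rfl⟩
      obtain ⟨⟨x, hx⟩, rfl⟩ := Submodule.Quotient.mk_surjective _ x
      obtain ⟨⟨y, hy⟩, rfl⟩ := Submodule.Quotient.mk_surjective _ y
      have h1 := (hcol (x + y)).mpr (Submodule.add_mem_sup hx hy)
      refine ⟨Submodule.liftQ _ (LinearMap.toSpanSingleton R (R ⧸ B)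
        (Submodule.Quotient.mk (x + y))) ?_, ?_⟩
      · rw [Ideal.span, Submodule.span_le, Set.singleton_subset_iff]
        change a • (Submodule.Quotient.mk (x + y) : R ⧸ B) = 0
        rw [← Submodule.Quotient.mk_smul, Submodule.Quotient.mk_eq_zero, smul_eq_mul, mul_comm]
        exact h1
      · change (1 : R) • (Submodule.Quotient.mk (x + y) : R ⧸ B) = _
        rw [one_smul]
        rfl
  exact ⟨(LinearEquiv.ofInjective ev hev).trans
    ((LinearEquiv.ofEq _ _ hr).trans (LinearEquiv.ofInjective F hF).symm)⟩

/-- Let `R` be a Noetherian local ring of dimension one and depth zero,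
`n > 0` with `𝔪^n ∩ Γ_𝔪(R) = 0`, `a ∈ 𝔪^n` a parameter and `b = c a^2` a parameter. Then
`((b) : a) = (ca) + Γ_𝔪(R)`, `(c a^2) = (ca) ∩ (Γ_𝔪(R) + (c a^2))`, and consequently
`Hom_R(R/(a), R/(b)) ≅ (ca)/(ca^2) ⊕ (Γ_𝔪(R) + (ca^2))/(ca^2)` as `R/(a)`-modules, with both
summands nonzero and `(ca)/(ca^2)` not free over `R/(a)`. The (unique) `R/(a)`-module
structures compatible with the `R`-module structures are taken as instance hypotheses. -/
theorem hom_decomposition_dim_one_ring {R : Type*} [CommRing R] [IsNoetherianRing R]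
    [IsLocalRing R]
    (hdim : ringKrullDim R = 1) (hdepth : moduleDepth R R = 0)
    (n : ℕ) (hn : 0 < n)
    (hGamma : (maximalIdeal R ^ n : Ideal R) ⊓ torsionGamma (maximalIdeal R) R = ⊥)
    (a : R) (han : a ∈ maximalIdeal R ^ n) (ha : IsParameter R R a)
    (c b : R) (hbdef : b = c * a ^ 2) (hb : IsParameter R R b)
    [Module (R ⧸ Ideal.span {a}) ((R ⧸ Ideal.span {a}) →ₗ[R] (R ⧸ Ideal.span {b}))]
    [IsScalarTower R (R ⧸ Ideal.span {a})
      ((R ⧸ Ideal.span {a}) →ₗ[R] (R ⧸ Ideal.span {b}))]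
    [Module (R ⧸ Ideal.span {a}) (↥(Ideal.span {c * a}) ⧸
      Submodule.comap (Ideal.span {c * a}).subtype (Ideal.span {b}))]
    [IsScalarTower R (R ⧸ Ideal.span {a}) (↥(Ideal.span {c * a}) ⧸
      Submodule.comap (Ideal.span {c * a}).subtype (Ideal.span {b}))]
    [Module (R ⧸ Ideal.span {a}) (↥(torsionGamma (maximalIdeal R) R ⊔ Ideal.span {b}) ⧸
      Submodule.comap (torsionGamma (maximalIdeal R) R ⊔ Ideal.span {b}).subtype
        (Ideal.span {b}))]
    [IsScalarTower R (R ⧸ Ideal.span {a})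
      (↥(torsionGamma (maximalIdeal R) R ⊔ Ideal.span {b}) ⧸
        Submodule.comap (torsionGamma (maximalIdeal R) R ⊔ Ideal.span {b}).subtype
          (Ideal.span {b}))] :
    Submodule.colon (Ideal.span {b}) (Ideal.span {a}) =
      Ideal.span {c * a} ⊔ torsionGamma (maximalIdeal R) R ∧
    Ideal.span {b} = Ideal.span {c * a} ⊓
      (torsionGamma (maximalIdeal R) R ⊔ Ideal.span {b}) ∧
    Nonempty (((R ⧸ Ideal.span {a}) →ₗ[R] (R ⧸ Ideal.span {b})) ≃ₗ[R ⧸ Ideal.span {a}]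
      ((↥(Ideal.span {c * a}) ⧸
          Submodule.comap (Ideal.span {c * a}).subtype (Ideal.span {b})) ×
        (↥(torsionGamma (maximalIdeal R) R ⊔ Ideal.span {b}) ⧸
          Submodule.comap (torsionGamma (maximalIdeal R) R ⊔ Ideal.span {b}).subtype
            (Ideal.span {b})))) ∧
    Nontrivial (↥(Ideal.span {c * a}) ⧸
      Submodule.comap (Ideal.span {c * a}).subtype (Ideal.span {b})) ∧
    Nontrivial (↥(torsionGamma (maximalIdeal R) R ⊔ Ideal.span {b}) ⧸
      Submodule.comap (torsionGamma (maximalIdeal R) R ⊔ Ideal.span {b}).subtype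
        (Ideal.span {b})) ∧
    ¬ Module.Free (R ⧸ Ideal.span {a}) (↥(Ideal.span {c * a}) ⧸
      Submodule.comap (Ideal.span {c * a}).subtype (Ideal.span {b})) := by
  have ham : a ∈ maximalIdeal R := (mem_maximalIdeal a).mpr ha.1
  obtain ⟨k, hk⟩ := aux_pow_le a ha
  obtain ⟨l, hl⟩ := aux_pow_le b hb
  -- elements of Γ lying in 𝔪^n vanish
  have hz : ∀ g ∈ torsionGamma (maximalIdeal R) R, g ∈ maximalIdeal R ^ n → g = 0 := by
    intro g hg hg'
    have : g ∈ (maximalIdeal R ^ n : Ideal R) ⊓ torsionGamma (maximalIdeal R) R := ⟨hg', hg⟩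
    rw [hGamma] at this
    exact this
  have hag : ∀ g ∈ torsionGamma (maximalIdeal R) R, a * g = 0 := fun g hg =>
    hz _ (Submodule.smul_mem _ a hg) (Ideal.mul_mem_right _ _ han)
  have hga : ∀ g : R, a * g = 0 → g ∈ torsionGamma (maximalIdeal R) R := by
    intro g hg
    refine ⟨k, fun r hr => ?_⟩
    obtain ⟨s, rfl⟩ := Ideal.mem_span_singleton'.mp (hk hr)
    rw [smul_eq_mul, mul_assoc, hg, mul_zero]
  have hbspan : Ideal.span {b} ≤ Ideal.span {c * a} := by
    rw [Ideal.span_singleton_le_span_singleton]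
    exact ⟨a, by rw [hbdef]; ring⟩
  have hban : b ∈ maximalIdeal R ^ n := by
    rw [hbdef, pow_two, ← mul_assoc]
    exact Ideal.mul_mem_left _ _ han
  have hcol : ∀ r : R, r * a ∈ Ideal.span {b} ↔
      r ∈ Ideal.span {c * a} ⊔ torsionGamma (maximalIdeal R) R := by
    intro r
    constructor
    · intro h
      obtain ⟨s, hs⟩ := Ideal.mem_span_singleton'.mp h
      refine Submodule.mem_sup.mpr ⟨s * (c * a), Ideal.mem_span_singleton'.mpr ⟨s, rfl⟩,
        r - s * (c * a), hga _ ?_, by ring⟩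
      rw [hbdef] at hs
      linear_combination -hs
    · intro h
      obtain ⟨x, hx, g, hg, rfl⟩ := Submodule.mem_sup.mp h
      obtain ⟨s, rfl⟩ := Ideal.mem_span_singleton'.mp hx
      refine Ideal.mem_span_singleton'.mpr ⟨s, ?_⟩
      rw [hbdef]
      linear_combination -(hag g hg)
  have hinter : Ideal.span {c * a} ⊓ (torsionGamma (maximalIdeal R) R ⊔ Ideal.span {b}) ≤
      Ideal.span {b} := by
    rintro x ⟨hx, hx'⟩
    obtain ⟨g, hg, y, hy, rfl⟩ := Submodule.mem_sup.mp hx'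
    have hg1 : g ∈ Ideal.span {c * a} := by
      simpa using Ideal.sub_mem _ hx (hbspan hy)
    have : g = 0 := by
      refine hz g hg ?_
      obtain ⟨s, rfl⟩ := Ideal.mem_span_singleton'.mp hg1
      exact Ideal.mul_mem_left _ _ (Ideal.mul_mem_left _ _ han)
    rw [this, zero_add]
    exact hy
  have hb0 : b ≠ 0 := by
    intro h0
    have hnil : IsNilpotent (maximalIdeal R) := by
      refine ⟨l, ?_⟩
      rw [h0] at hl
      simpa using hl
    have := (isArtinianRing_iff_isNilpotent_maximalIdeal R).mpr hnil
    have h2 : Ring.KrullDimLE 0 R := inferInstance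
    have h3 := (ringKrullDimZero_iff_ringKrullDim_eq_zero (R := R)).mp h2
    rw [hdim] at h3
    exact one_ne_zero h3
  have hG0 : ∃ g ∈ torsionGamma (maximalIdeal R) R, g ≠ 0 := by
    by_contra! hcon
    have hreg : RingTheory.Sequence.IsRegular R [a] := by
      refine ⟨(RingTheory.Sequence.isWeaklyRegular_singleton_iff R a).mpr ?_, ?_⟩
      · intro x y hxy
        have hxy' : a * x = a * y := hxy
        exact sub_eq_zero.mp (hcon _ (hga _ (by rw [mul_sub, hxy', sub_self])))
      · rw [Ideal.ofList_singleton, smul_eq_mul, Ideal.mul_top]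
        intro h
        exact ha.1 (Ideal.span_singleton_eq_top.mp h.symm)
    have h1 : (1 : ℕ∞) ≤ moduleDepth R R :=
      le_sSup ⟨[a], by simp, by simpa using ha.1, hreg⟩
    rw [hdepth] at h1
    simp at h1
  obtain ⟨g, hg, hgne⟩ := hG0
  have hN1 : Nontrivial (↥(Ideal.span {c * a}) ⧸
      Submodule.comap (Ideal.span {c * a}).subtype (Ideal.span {b})) := by
    rw [Submodule.Quotient.nontrivial_iff]
    intro h
    have hmem : (⟨c * a, Ideal.mem_span_singleton_self _⟩ : ↥(Ideal.span {c * a})) ∈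
        Submodule.comap (Ideal.span {c * a}).subtype (Ideal.span {b}) := by
      rw [h]; trivial
    obtain ⟨s, hs⟩ := Ideal.mem_span_singleton'.mp (show c * a ∈ Ideal.span {b} from hmem)
    have hu : IsUnit (1 - s * a) := by
      by_contra hnu
      have h1 : (1 - s * a) ∈ maximalIdeal R := hnu
      have h2 := Ideal.add_mem _ h1 (Ideal.mul_mem_left _ s ham)
      rw [sub_add_cancel] at h2
      exact h2 isUnit_one
    have hca : c * a = 0 := by
      refine (hu.mul_left_eq_zero).mp ?_
      rw [hbdef] at hs
      linear_combination -hs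
    exact hb0 (by rw [hbdef, pow_two, ← mul_assoc, hca, zero_mul])
  refine ⟨?_, ?_, ?_, hN1, ?_, ?_⟩
  · ext r
    rw [← hcol r]
    exact Ideal.mem_colon_span_singleton
  · exact le_antisymm (le_inf hbspan le_sup_right) hinter
  · obtain ⟨e⟩ := aux_iso a (Ideal.span {b}) (Ideal.span {c * a})
      (torsionGamma (maximalIdeal R) R ⊔ Ideal.span {b}) hbspan le_sup_right hinter (by
        intro r
        rw [hcol r, sup_comm (torsionGamma (maximalIdeal R) R), ← sup_assoc,
          sup_eq_left.mpr hbspan])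
    exact ⟨e.extendScalarsOfSurjective (S := R ⧸ Ideal.span {a}) Ideal.Quotient.mk_surjective⟩
  · rw [Submodule.Quotient.nontrivial_iff]
    intro h
    have hmem : (⟨g, Submodule.mem_sup_left hg⟩ :
        ↥(torsionGamma (maximalIdeal R) R ⊔ Ideal.span {b})) ∈
        Submodule.comap (torsionGamma (maximalIdeal R) R ⊔ Ideal.span {b}).subtype
          (Ideal.span {b}) := by
      rw [h]; trivial
    have hmem' : g ∈ Ideal.span {b} := hmem
    exact hgne (hz g hg ((Ideal.span_singleton_le_iff_mem _).mpr hban hmem'))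
  · intro hfree
    have hA : FaithfulSMul (R ⧸ Ideal.span {a}) (↥(Ideal.span {c * a}) ⧸
      Submodule.comap (Ideal.span {c * a}).subtype (Ideal.span {b})) := inferInstance
    have h0 : algebraMap R (R ⧸ Ideal.span {a}) g = 0 := by
      refine hA.eq_of_smul_eq_smul fun m => ?_
      rw [zero_smul, algebraMap_smul]
      obtain ⟨⟨x, hx⟩, rfl⟩ := Submodule.Quotient.mk_surjective _ m
      rw [← Submodule.Quotient.mk_smul]
      have : g • (⟨x, hx⟩ : ↥(Ideal.span {c * a})) = 0 := by
        ext
        obtain ⟨s, rfl⟩ := Ideal.mem_span_singleton'.mp hx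
        change g * (s * (c * a)) = 0
        linear_combination (s * c) * hag g hg
      rw [this, Submodule.Quotient.mk_zero]
    have h1 : g ∈ Ideal.span {a} := Ideal.Quotient.eq_zero_iff_mem.mp h0
    exact hgne (hz g hg ((Ideal.span_singleton_le_iff_mem _).mpr han h1))
end

section
/- Let k be a field and R = k[[x,y]]/(x^2, x y^2). Then y is a parameter of R and there are isomorphisms Hom_R(R/(y), R/(y^2)) ≅ ((y^2) :_R y)/(y^2) = (y)/(y^2) ≅ R/(y); in particular Hom_R(R/(y), R/(y^2)) is a free R/(y)-module of rank one even though R is not Cohen-Macaulay. -/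
set_option maxHeartbeats 2000000
set_option synthInstance.maxHeartbeats 1000000

/-- The ring `k[[x,y]]/(x^2, x y^2)`. -/
abbrev ExampleRingXY (k : Type*) [Field k] : Type _ :=
  MvPowerSeries (Fin 2) k ⧸
    (Ideal.span {MvPowerSeries.X 0 ^ 2, MvPowerSeries.X 0 * MvPowerSeries.X 1 ^ 2} :
      Ideal (MvPowerSeries (Fin 2) k))

open MvPowerSeries in
theorem exists_split {k : Type*} [Field k] (s : Fin 2) (f : MvPowerSeries (Fin 2) k) :
    ∃ g r : MvPowerSeries (Fin 2) k, f = X s * g + r ∧ (∀ m, m s ≠ 0 → coeff m r = 0) ∧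
      (∀ m, m s = 0 → coeff m r = coeff m f) := by
  classical
  let r : MvPowerSeries (Fin 2) k := fun m => if m s = 0 then coeff m f else 0
  have hr : ∀ m, coeff m r = if m s = 0 then coeff m f else 0 := fun m => rfl
  have hd : X s ∣ f - r := by
    rw [X_dvd_iff]
    intro m hm
    rw [map_sub, hr, if_pos hm, sub_self]
  obtain ⟨g, hg⟩ := hd
  refine ⟨g, r, ?_, ?_, ?_⟩
  · rw [← hg]; ring
  · intro m hm; rw [hr, if_neg hm]
  · intro m hm; rw [hr, if_pos hm]

open MvPowerSeries in
theorem exists_decomp {k : Type*} [Field k] (f : MvPowerSeries (Fin 2) k) :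
    ∃ g h : MvPowerSeries (Fin 2) k, f = C (constantCoeff f) + X 0 * g + X 1 * h := by
  classical
  obtain ⟨g, r, h1, h2, h3⟩ := exists_split 0 f
  have hd : X 1 ∣ r - C (constantCoeff f) := by
    rw [X_dvd_iff]
    intro m hm
    rw [map_sub, coeff_C]
    by_cases h0 : m 0 = 0
    · have : m = 0 := by
        ext i
        fin_cases i
        · exact h0
        · exact hm
      subst this
      rw [h3 _ h0]
      simp
    · rw [h2 _ h0, if_neg, sub_self]
      rintro rfl
      exact h0 rfl
  obtain ⟨h, hh⟩ := hd
  refine ⟨g, h, ?_⟩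
  rw [← hh]
  linear_combination h1

open MvPowerSeries in
theorem mvX_prime {k : Type*} [Field k] (s : Fin 2) {a b : MvPowerSeries (Fin 2) k}
    (hab : X s ∣ a * b) : X s ∣ a ∨ X s ∣ b := by
  classical
  obtain ⟨g, r, h1, h2, h3⟩ := exists_split s a
  obtain ⟨g', r', h1', h2', h3'⟩ := exists_split s b
  have hd : X s ∣ r * r' := by
    have : r * r' = a * b - X s * (g * b + r * g') := by
      rw [h1, h1']; ring
    rw [this]
    exact dvd_sub hab (dvd_mul_right _ _)
  have h0 : r * r' = 0 := by
    ext m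
    by_cases hm : m s = 0
    · rw [X_dvd_iff.mp hd m hm]; simp
    · rw [coeff_mul, map_zero]
      apply Finset.sum_eq_zero
      intro p hp
      rw [Finset.HasAntidiagonal.mem_antidiagonal] at hp
      by_cases hp1 : p.1 s = 0
      · have : p.2 s ≠ 0 := by
          intro h
          apply hm
          rw [← hp, Finsupp.add_apply, hp1, h]
        rw [h2' _ this, mul_zero]
      · rw [h2 _ hp1, zero_mul]
  rcases mul_eq_zero.mp h0 with h | h
  · left; rw [h1, h, add_zero]; exact dvd_mul_right _ _
  · right; rw [h1', h, add_zero]; exact dvd_mul_right _ _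

open MvPowerSeries in
theorem mvX_not_dvd {k : Type*} [Field k] {s t : Fin 2} (hst : s ≠ t) :
    ¬ (X s ∣ (X t : MvPowerSeries (Fin 2) k)) := by
  classical
  intro h
  have := X_dvd_iff.mp h (Finsupp.single t 1) (by simp [hst])
  simp [coeff_X] at this

open MvPowerSeries in
theorem mvX_not_dvd_of_const {k : Type*} [Field k] {s : Fin 2} {f : MvPowerSeries (Fin 2) k}
    (hf : constantCoeff f ≠ 0) : ¬ (X s ∣ f) := by
  intro h
  have := X_dvd_iff.mp h 0 (by simp)
  exact hf (by simpa using this)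

section general
variable {R : Type*} [CommRing R] (y : R)

theorem homColonEquiv :
    Nonempty (((R ⧸ Ideal.span {y}) →ₗ[R] (R ⧸ Ideal.span {y ^ 2})) ≃ₗ[R]
      (↥(Submodule.colon (Ideal.span {y ^ 2}) (Ideal.span {y})) ⧸
        Submodule.comap (Submodule.colon (Ideal.span {y ^ 2}) (Ideal.span {y})).subtype
          (Ideal.span {y ^ 2}))) := by
  let C : Ideal R := Submodule.colon (Ideal.span {y ^ 2}) (Ideal.span {y})
  let φ : C →ₗ[R] ((R ⧸ Ideal.span {y}) →ₗ[R] (R ⧸ Ideal.span {y ^ 2})) :=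
    { toFun := fun c => Submodule.mapQ _ _ (LinearMap.mulLeft R (c : R)) (by
        intro r hr
        exact (Submodule.mem_colon.mp c.2) r hr)
      map_add' := by
        intro a b
        apply Submodule.linearMap_qext
        ext
        change (Submodule.Quotient.mk (((a : R) + (b : R)) * 1) : R ⧸ Ideal.span {y ^ 2}) =
          Submodule.Quotient.mk ((a : R) * 1) + Submodule.Quotient.mk ((b : R) * 1)
        rw [add_mul, Submodule.Quotient.mk_add]
      map_smul' := by
        intro a b
        apply Submodule.linearMap_qext
        ext
        change (Submodule.Quotient.mk ((a * (b : R)) * 1) : R ⧸ Ideal.span {y ^ 2}) =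
          a • Submodule.Quotient.mk ((b : R) * 1)
        rw [mul_assoc, ← Submodule.Quotient.mk_smul, smul_eq_mul] }
  have hφ : ∀ (c : C) (r : R), φ c (Submodule.Quotient.mk r) = Submodule.Quotient.mk ((c : R) * r) :=
    fun c r => rfl
  have hker : LinearMap.ker φ = Submodule.comap C.subtype (Ideal.span {y ^ 2}) := by
    ext c
    rw [LinearMap.mem_ker, Submodule.mem_comap]
    constructor
    · intro h
      have h1 := hφ c 1
      rw [h, mul_one] at h1
      exact (Submodule.Quotient.mk_eq_zero _).mp h1.symm
    · intro h
      apply Submodule.linearMap_qext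
      ext
      change φ c (Submodule.Quotient.mk 1) = 0
      rw [hφ, mul_one]
      exact (Submodule.Quotient.mk_eq_zero _).mpr h
  have hsurj : Function.Surjective φ := by
    intro ψ
    obtain ⟨c, hc⟩ := Submodule.Quotient.mk_surjective _ (ψ (Submodule.Quotient.mk 1))
    have hψ : ∀ r : R, ψ (Submodule.Quotient.mk r) = Submodule.Quotient.mk (c * r) := by
      intro r
      have : (Submodule.Quotient.mk r : R ⧸ Ideal.span {y}) = r • Submodule.Quotient.mk 1 := by
        rw [← Submodule.Quotient.mk_smul, smul_eq_mul, mul_one]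
      rw [this, map_smul, ← hc, ← Submodule.Quotient.mk_smul, smul_eq_mul, mul_comm]
    have hcm : c ∈ C := by
      refine Submodule.mem_colon.mpr fun r hr => ?_
      have := hψ r
      rw [(Submodule.Quotient.mk_eq_zero _).mpr hr, map_zero] at this
      exact (Submodule.Quotient.mk_eq_zero _).mp this.symm
    refine ⟨⟨c, hcm⟩, ?_⟩
    apply Submodule.linearMap_qext
    ext
    change φ _ (Submodule.Quotient.mk 1) = ψ (Submodule.Quotient.mk 1)
    rw [hφ, hψ]
  exact ⟨((Submodule.quotEquivOfEq _ _ hker).symm.trans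
    (φ.quotKerEquivOfSurjective hsurj)).symm⟩

theorem idealQuotEquiv (hC : ∀ r : R, r * y ∈ Ideal.span {y ^ 2} → r ∈ Ideal.span {y}) :
    Nonempty ((↥(Ideal.span {y}) ⧸
        Submodule.comap (Ideal.span {y} : Ideal R).subtype
          (Ideal.span {y ^ 2})) ≃ₗ[R] (R ⧸ Ideal.span {y})) := by
  let N := Submodule.comap (Ideal.span {y} : Ideal R).subtype (Ideal.span {y ^ 2})
  let φ : R →ₗ[R] (↥(Ideal.span {y}) ⧸ N) :=
    LinearMap.toSpanSingleton R _ (N.mkQ ⟨y, Ideal.mem_span_singleton_self y⟩)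
  have hφ : ∀ r : R, φ r = N.mkQ (r • ⟨y, Ideal.mem_span_singleton_self y⟩) := by
    intro r
    rw [map_smul]; rfl
  have hker : LinearMap.ker φ = Ideal.span {y} := by
    ext r
    rw [LinearMap.mem_ker, hφ, Submodule.mkQ_apply, Submodule.Quotient.mk_eq_zero,
      Submodule.mem_comap]
    change r * y ∈ Ideal.span {y ^ 2} ↔ _
    refine ⟨hC r, fun h => ?_⟩
    obtain ⟨a, rfl⟩ := Ideal.mem_span_singleton'.mp h
    exact Ideal.mem_span_singleton'.mpr ⟨a, by ring⟩
  have hsurj : Function.Surjective φ := by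
    intro z
    obtain ⟨⟨w, hw⟩, rfl⟩ := Submodule.mkQ_surjective _ z
    obtain ⟨a, rfl⟩ := Ideal.mem_span_singleton'.mp hw
    exact ⟨a, hφ a⟩
  exact ⟨((Submodule.quotEquivOfEq _ _ hker).symm.trans
    (φ.quotKerEquivOfSurjective hsurj)).symm⟩

theorem freeOfEquiv (I : Ideal R) (hI : I ≠ ⊤) (M : Type*) [AddCommGroup M] [Module R M]
    [Module (R ⧸ I) M] [IsScalarTower R (R ⧸ I) M] (e : M ≃ₗ[R] (R ⧸ I)) :
    Module.Free (R ⧸ I) M ∧ Module.rank (R ⧸ I) M = 1 := by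
  haveI : Nontrivial (R ⧸ I) := Ideal.Quotient.nontrivial_iff.mpr hI
  let e' : M ≃ₗ[R ⧸ I] (R ⧸ I) :=
    e.extendScalarsOfSurjective (Ideal.Quotient.mk_surjective)
  refine ⟨Module.Free.of_equiv e'.symm, ?_⟩
  have := e'.lift_rank_eq
  rw [Module.rank_self] at this
  simpa using this

end general

theorem comb_aux {k S : Type*} [Field k] [CommRing S] [Algebra k S] (c d : k) (x f g g' : S)
    (hx : x * x = 0) (e1 : g = d • (1 : S) + x * g') (e2 : f = c • (1 : S) + x * g) :
    c • (1 : S) + d • x = f := by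
  rw [e2, e1, mul_add, ← mul_assoc, hx, zero_mul, add_zero, mul_smul_comm, mul_one]

section ex
open MvPowerSeries
variable {k : Type*} [Field k]

theorem mem_I {f : MvPowerSeries (Fin 2) k} :
    f ∈ (Ideal.span {X 0 ^ 2, X 0 * X 1 ^ 2} : Ideal (MvPowerSeries (Fin 2) k)) ↔
      ∃ a b, a * X 0 ^ 2 + b * (X 0 * X 1 ^ 2) = f := Ideal.mem_span_pair

theorem ex_colon (r : ExampleRingXY k)
    (h : r * Ideal.Quotient.mk _ (X 1) ∈
      (Ideal.span {(Ideal.Quotient.mk _ (X 1)) ^ 2} : Ideal (ExampleRingXY k))) :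
    r ∈ (Ideal.span {Ideal.Quotient.mk _ (X 1)} : Ideal (ExampleRingXY k)) := by
  obtain ⟨g, hg⟩ := Ideal.mem_span_singleton'.mp h
  obtain ⟨f, rfl⟩ := Ideal.Quotient.mk_surjective r
  obtain ⟨g, rfl⟩ := Ideal.Quotient.mk_surjective g
  rw [← map_pow, ← map_mul, ← map_mul, Ideal.Quotient.eq, mem_I] at hg
  obtain ⟨a, b, hab⟩ := hg
  have hd : (X 1 : MvPowerSeries (Fin 2) k) ∣ a * X 0 ^ 2 :=
    ⟨g * X 1 - f - b * (X 0 * X 1), by linear_combination hab⟩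
  have hn : ¬ (X 1 : MvPowerSeries (Fin 2) k) ∣ X 0 := mvX_not_dvd (by decide)
  have ha : (X 1 : MvPowerSeries (Fin 2) k) ∣ a := by
    rcases mvX_prime 1 hd with h | h
    · exact h
    · rw [pow_two] at h
      rcases mvX_prime 1 h with h | h <;> exact absurd h hn
  obtain ⟨a', rfl⟩ := ha
  have hX : (X 1 : MvPowerSeries (Fin 2) k) ≠ 0 := by
    intro h0; rw [h0] at hab
    exact (mvX_not_dvd (k := k) (s := 0) (t := 1) (by decide)) (by rw [h0]; exact dvd_zero _)
  have hf : f = (g - b * X 0) * X 1 - a' * X 0 ^ 2 := by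
    apply mul_left_cancel₀ hX
    linear_combination hab
  refine Ideal.mem_span_singleton'.mpr ⟨Ideal.Quotient.mk _ (g - b * X 0), ?_⟩
  rw [← map_mul, Ideal.Quotient.eq, mem_I]
  exact ⟨a', 0, by rw [hf]; ring⟩

theorem ex_const {f : MvPowerSeries (Fin 2) k}
    (hf : f ∈ (Ideal.span {X 0 ^ 2, X 0 * X 1 ^ 2} : Ideal (MvPowerSeries (Fin 2) k))) :
    constantCoeff f = 0 := by
  obtain ⟨a, b, rfl⟩ := mem_I.mp hf
  simp

theorem ex_nonunit : (Ideal.Quotient.mk _ (X 1) : ExampleRingXY k) ∈ nonunits (ExampleRingXY k) := by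
  intro h
  obtain ⟨g, hg⟩ := isUnit_iff_exists_inv.mp h
  obtain ⟨g, rfl⟩ := Ideal.Quotient.mk_surjective g
  rw [← map_mul, ← map_one (Ideal.Quotient.mk _), Ideal.Quotient.eq] at hg
  have := ex_const hg
  simp at this

theorem finite_aux {k S : Type*} [Field k] [CommRing S] [Algebra k S]
    (q : MvPowerSeries (Fin 2) k →ₐ[k] S) (hq : Function.Surjective q) (hq1 : q (X 1) = 0)
    (hq0 : q (X 0) * q (X 0) = 0) : Module.Finite k S := by
  have hqC : ∀ c : k, q (C c) = c • 1 := by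
    intro c
    have : (C c : MvPowerSeries (Fin 2) k) = algebraMap k _ c := rfl
    rw [this, AlgHom.commutes, Algebra.algebraMap_eq_smul_one]
  classical
  refine ⟨⟨{1, q (X 0)}, ?_⟩⟩
  rw [eq_top_iff]
  intro z _
  obtain ⟨f, rfl⟩ := hq z
  obtain ⟨g, h, hf⟩ := exists_decomp f
  obtain ⟨g', h', hg⟩ := exists_decomp g
  rw [Finset.coe_pair, Submodule.mem_span_pair]
  refine ⟨constantCoeff f, constantCoeff g, ?_⟩
  have e1 : q g = constantCoeff g • 1 + q (X 0) * q g' := by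
    conv_lhs => rw [hg]
    rw [map_add, map_add, map_mul, map_mul, hq1, hqC]; ring
  have e2 : q f = constantCoeff f • 1 + q (X 0) * q g := by
    conv_lhs => rw [hf]
    rw [map_add, map_add, map_mul, map_mul, hq1, hqC]; ring
  exact comb_aux _ _ _ _ _ _ hq0 e1 e2

theorem finlen_aux {k R : Type*} [Field k] [CommRing R] [Algebra k R]
    (p : MvPowerSeries (Fin 2) k →ₐ[k] R) (hp : Function.Surjective p)
    (hp0 : p (X 0 ^ 2) = 0) : IsFiniteLength R (R ⧸ Ideal.span {p (X 1)}) := by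
  have hfin : Module.Finite k (R ⧸ Ideal.span {p (X 1)}) := by
    refine finite_aux ((Ideal.Quotient.mkₐ k (Ideal.span {p (X 1)})).comp p) ?_ ?_ ?_
    · exact Ideal.Quotient.mk_surjective.comp hp
    · exact Ideal.Quotient.eq_zero_iff_mem.mpr (Ideal.mem_span_singleton_self _)
    · rw [← map_mul, ← pow_two, AlgHom.comp_apply, hp0, map_zero]
  rw [isFiniteLength_iff_isNoetherian_isArtinian]
  exact ⟨isNoetherian_of_tower k inferInstance, isArtinian_of_tower k inferInstance⟩

theorem ex_finite : IsFiniteLength (ExampleRingXY k) (ExampleRingXY k ⧸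
    (Ideal.span {(Ideal.Quotient.mk _ (X 1) : ExampleRingXY k)})) := by
  refine finlen_aux (k := k) (R := ExampleRingXY k) (Ideal.Quotient.mkₐ k _) ?_ ?_
  · exact Ideal.Quotient.mk_surjective
  · exact Ideal.Quotient.eq_zero_iff_mem.mpr (mem_I.mpr ⟨1, 0, by ring⟩)

theorem ex_xy_ne : (Ideal.Quotient.mk _ (X 0 * X 1) : ExampleRingXY k) ≠ 0 := by
  intro h
  rw [Ideal.Quotient.eq_zero_iff_mem, mem_I] at h
  obtain ⟨a, b, hab⟩ := h
  have hX : (X 0 : MvPowerSeries (Fin 2) k) ≠ 0 := by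
    intro h0
    exact (mvX_not_dvd (k := k) (s := 1) (t := 0) (by decide)) (by rw [h0]; exact dvd_zero _)
  have h1 : X 1 * (1 - b * X 1) = X 0 * a := by
    apply mul_left_cancel₀ hX
    linear_combination -hab
  rcases mvX_prime 0 ⟨a, h1⟩ with h | h
  · exact mvX_not_dvd (by decide) h
  · exact mvX_not_dvd_of_const (by simp) h

theorem ex_kill (r : ExampleRingXY k) (hr : r ∈ nonunits (ExampleRingXY k)) :
    r * Ideal.Quotient.mk _ (X 0 * X 1) = 0 := by
  obtain ⟨f, rfl⟩ := Ideal.Quotient.mk_surjective r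
  have hc : constantCoeff f = 0 := by
    by_contra h
    apply hr
    have : IsUnit f := isUnit_iff_constantCoeff.mpr (isUnit_iff_ne_zero.mpr h)
    exact this.map _
  obtain ⟨g, h, hf⟩ := exists_decomp f
  rw [hc, map_zero, zero_add] at hf
  rw [← map_mul, Ideal.Quotient.eq_zero_iff_mem, mem_I]
  exact ⟨g * X 1, h, by rw [hf]; ring⟩

theorem ex_depth : moduleDepth (ExampleRingXY k) (ExampleRingXY k) = 0 := by
  rw [moduleDepth, ← nonpos_iff_eq_zero]
  apply sSup_le
  rintro n ⟨rs, rfl, hn, hreg⟩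
  cases rs with
  | nil => simp
  | cons r rs =>
    exfalso
    have h1 := ((RingTheory.Sequence.isRegular_cons_iff _ _ _).mp hreg).1
    apply ex_xy_ne (k := k)
    apply h1
    change r * _ = r * 0
    rw [mul_zero]
    exact ex_kill r (hn r (by simp))

theorem ex_dim : moduleDim (ExampleRingXY k) (ExampleRingXY k) ≠ 0 := by
  intro h0
  let P : Ideal (MvPowerSeries (Fin 2) k) := Ideal.span {X 0}
  have hP : P.IsPrime := by
    refine ⟨?_, ?_⟩
    · rw [Ideal.ne_top_iff_one, Ideal.mem_span_singleton]
      exact mvX_not_dvd_of_const (by simp)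
    · intro a b hab
      rw [Ideal.mem_span_singleton] at hab ⊢
      rw [Ideal.mem_span_singleton]
      exact mvX_prime 0 hab
  let p1 : ExampleRingXY k →+* (MvPowerSeries (Fin 2) k ⧸ P) :=
    Ideal.Quotient.lift _ (Ideal.Quotient.mk P) (by
      intro f hf
      obtain ⟨a, b, rfl⟩ := mem_I.mp hf
      rw [Ideal.Quotient.eq_zero_iff_mem, Ideal.mem_span_singleton]
      exact ⟨a * X 0 + b * X 1 ^ 2, by ring⟩)
  have hp1 : Function.Surjective p1 := Ideal.Quotient.lift_surjective_of_surjective _ _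
    Ideal.Quotient.mk_surjective
  let p2 : (ExampleRingXY k ⧸ Module.annihilator (ExampleRingXY k) (ExampleRingXY k)) →+*
      (MvPowerSeries (Fin 2) k ⧸ P) := Ideal.Quotient.lift _ p1 (by
        intro a ha
        have := Module.mem_annihilator.mp ha 1
        rw [smul_eq_mul, mul_one] at this
        rw [this, map_zero])
  have hp2 : Function.Surjective p2 := Ideal.Quotient.lift_surjective_of_surjective _ _ hp1
  have hle : ringKrullDim (MvPowerSeries (Fin 2) k ⧸ P) ≤
      ringKrullDim (ExampleRingXY k ⧸ Module.annihilator (ExampleRingXY k) (ExampleRingXY k)) :=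
    ringKrullDim_le_of_surjective p2 hp2
  rw [moduleDim] at h0
  rw [h0] at hle
  haveI : Ring.KrullDimLE 0 (MvPowerSeries (Fin 2) k ⧸ P) :=
    Ring.krullDimLE_iff.mpr (by exact_mod_cast hle)
  have hmax : (⊥ : Ideal (MvPowerSeries (Fin 2) k ⧸ P)).IsMaximal := Ideal.isMaximal_of_isPrime _
  have hPm : P.IsMaximal := Ideal.bot_quotient_isMaximal_iff P |>.mp hmax
  have hX : X 1 ∉ P := by
    rw [Ideal.mem_span_singleton]
    exact mvX_not_dvd (by decide)
  obtain ⟨g, hg⟩ := hPm.exists_inv hX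
  obtain ⟨i, hi, h⟩ := hg
  obtain ⟨c, rfl⟩ := Ideal.mem_span_singleton.mp hi
  have := congrArg constantCoeff h
  simp at this

end ex

/-- Let `R = k[[x,y]]/(x^2, x y^2)` and `y` the image of the second
variable. Then `y` is a parameter of `R`,
`Hom_R(R/(y), R/(y^2)) ≅ ((y^2) :_R y)/(y^2)`, `((y^2) :_R y) = (y)`, and
`(y)/(y^2) ≅ R/(y)`; in particular `Hom_R(R/(y), R/(y^2))` is a free `R/(y)`-module of rank
one even though `R` is not Cohen-Macaulay. -/
theorem example_free_hom_not_cohenMacaulay (k : Type*) [Field k]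
    (y : ExampleRingXY k)
    (hy : y = Ideal.Quotient.mk _ (MvPowerSeries.X 1))
    [Module (ExampleRingXY k ⧸ Ideal.span {y})
      ((ExampleRingXY k ⧸ Ideal.span {y}) →ₗ[ExampleRingXY k]
        (ExampleRingXY k ⧸ Ideal.span {y ^ 2}))]
    [IsScalarTower (ExampleRingXY k) (ExampleRingXY k ⧸ Ideal.span {y})
      ((ExampleRingXY k ⧸ Ideal.span {y}) →ₗ[ExampleRingXY k]
        (ExampleRingXY k ⧸ Ideal.span {y ^ 2}))] :
    IsParameter (ExampleRingXY k) (ExampleRingXY k) y ∧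
    Nonempty (((ExampleRingXY k ⧸ Ideal.span {y}) →ₗ[ExampleRingXY k]
        (ExampleRingXY k ⧸ Ideal.span {y ^ 2})) ≃ₗ[ExampleRingXY k]
      (↥(Submodule.colon (Ideal.span {y ^ 2}) (Ideal.span {y})) ⧸
        Submodule.comap (Submodule.colon (Ideal.span {y ^ 2}) (Ideal.span {y})).subtype
          (Ideal.span {y ^ 2}))) ∧
    Submodule.colon (Ideal.span {y ^ 2}) (Ideal.span {y}) = Ideal.span {y} ∧
    Nonempty ((↥(Ideal.span {y}) ⧸
        Submodule.comap (Ideal.span {y} : Ideal (ExampleRingXY k)).subtype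
          (Ideal.span {y ^ 2})) ≃ₗ[ExampleRingXY k]
      (ExampleRingXY k ⧸ Ideal.span {y})) ∧
    Module.Free (ExampleRingXY k ⧸ Ideal.span {y})
      ((ExampleRingXY k ⧸ Ideal.span {y}) →ₗ[ExampleRingXY k]
        (ExampleRingXY k ⧸ Ideal.span {y ^ 2})) ∧
    Module.rank (ExampleRingXY k ⧸ Ideal.span {y})
      ((ExampleRingXY k ⧸ Ideal.span {y}) →ₗ[ExampleRingXY k]
        (ExampleRingXY k ⧸ Ideal.span {y ^ 2})) = 1 ∧
    ¬ IsCohenMacaulay (ExampleRingXY k) (ExampleRingXY k) := by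
  subst hy
  have hcol := ex_colon (k := k)
  have hceq : Submodule.colon
      (Ideal.span {(Ideal.Quotient.mk _ (MvPowerSeries.X 1) : ExampleRingXY k) ^ 2})
      (Ideal.span {(Ideal.Quotient.mk _ (MvPowerSeries.X 1) : ExampleRingXY k)}) =
      Ideal.span {(Ideal.Quotient.mk _ (MvPowerSeries.X 1) : ExampleRingXY k)} := by
    ext r
    rw [Ideal.mem_colon_span_singleton]
    refine ⟨hcol r, fun h => ?_⟩
    obtain ⟨a, rfl⟩ := Ideal.mem_span_singleton'.mp h
    exact Ideal.mem_span_singleton'.mpr ⟨a, by ring⟩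
  have h2 := homColonEquiv (Ideal.Quotient.mk _ (MvPowerSeries.X 1) : ExampleRingXY k)
  have h4 := idealQuotEquiv (Ideal.Quotient.mk _ (MvPowerSeries.X 1) : ExampleRingXY k) hcol
  have hne : (Ideal.span {(Ideal.Quotient.mk _ (MvPowerSeries.X 1) : ExampleRingXY k)}) ≠ ⊤ := by
    rw [Ne, Ideal.span_singleton_eq_top]
    exact ex_nonunit
  have h2' := h2
  rw [hceq] at h2'
  obtain ⟨e1⟩ := h2'
  obtain ⟨e2⟩ := h4
  have h5 := freeOfEquiv _ hne _ (e1.trans e2)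
  refine ⟨⟨ex_nonunit, ?_⟩, h2, hceq, ⟨e2⟩, h5.1, h5.2, ?_⟩
  · rw [smul_eq_mul, Ideal.mul_top]
    exact ex_finite
  · intro h
    rw [IsCohenMacaulay, ex_depth] at h
    exact ex_dim h.symm
end

section
/- Let k be a field and R = k[[x,y,z]]/(x^2, x y z). Then R is a two-dimensional Noetherian local ring of depth one, the pair y, z is a system of parameters of R, both y and z are zero-divisors in R, and both R/(y) and R/(z) are Cohen-Macaulay rings of dimension one. -/
set_option maxHeartbeats 2000000
set_option synthInstance.maxHeartbeats 1000000

/-- The ring `k[[x,y,z]]/(x^2, x y z)`. -/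
abbrev ExampleRingXYZ (k : Type*) [Field k] : Type _ :=
  MvPowerSeries (Fin 3) k ⧸
    (Ideal.span {MvPowerSeries.X 0 ^ 2,
      MvPowerSeries.X 0 * (MvPowerSeries.X 1 * MvPowerSeries.X 2)} :
      Ideal (MvPowerSeries (Fin 3) k))

open MvPowerSeries
namespace Ex
variable {k : Type*} [Field k]

noncomputable def e (i : Fin 3) : MvPowerSeries (Fin 3) k →+* MvPowerSeries (Fin 3) k :=
  rescale (Function.update 1 i 0)

lemma coeff_e (i : Fin 3) (f : MvPowerSeries (Fin 3) k) (n : Fin 3 →₀ ℕ) :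
    coeff n (e i f) = if n i = 0 then coeff n f else 0 := by
  rw [e, coeff_rescale, Finsupp.prod_fintype _ _ (by simp)]
  split_ifs with h
  · rw [Finset.prod_eq_one, one_mul]
    intro j _
    by_cases hj : j = i
    · subst hj; simp [h]
    · simp [Function.update_of_ne hj]
  · rw [Finset.prod_eq_zero (Finset.mem_univ i), zero_mul]
    simp [h]

lemma dvd_iff (i : Fin 3) (f : MvPowerSeries (Fin 3) k) : X i ∣ f ↔ e i f = 0 := by
  rw [X_dvd_iff]
  constructor
  · intro h
    ext n
    rw [coeff_e]
    split_ifs with hn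
    · simpa using h n hn
    · simp
  · intro h n hn
    have := coeff_e i f n
    rw [h, if_pos hn] at this
    simpa using this.symm

lemma e_e (i : Fin 3) (f : MvPowerSeries (Fin 3) k) : e i (e i f) = e i f := by
  ext n; simp only [coeff_e]; split_ifs <;> rfl

lemma e_comm (i j : Fin 3) (f : MvPowerSeries (Fin 3) k) : e i (e j f) = e j (e i f) := by
  ext n; simp only [coeff_e]; split_ifs <;> rfl

lemma dvd_sub (i : Fin 3) (f : MvPowerSeries (Fin 3) k) : X i ∣ f - e i f := by
  rw [dvd_iff, map_sub, e_e, sub_self]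

lemma e_self (i : Fin 3) : e i (X i : MvPowerSeries (Fin 3) k) = 0 :=
  (dvd_iff i _).1 dvd_rfl

lemma e_ne {i j : Fin 3} (h : i ≠ j) : e i (X j : MvPowerSeries (Fin 3) k) = X j := by
  ext n
  rw [coeff_e, coeff_X]
  split_ifs with h1 h2 h2 <;> try rfl
  subst h2
  simp [h.symm] at h1

lemma e_all (f : MvPowerSeries (Fin 3) k) : e 0 (e 1 (e 2 f)) = C (constantCoeff f) := by
  ext n
  simp only [coeff_e, coeff_C]
  by_cases hn : n = 0
  · subst hn; simp
  · rw [if_neg hn]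
    split_ifs with h0 h1 h2 <;> try rfl
    exfalso; apply hn; ext i; fin_cases i <;> assumption

lemma X_ne (i : Fin 3) : (X i : MvPowerSeries (Fin 3) k) ≠ 0 := by
  intro h
  have := congrArg (coeff (Finsupp.single i 1)) h
  simp [coeff_X] at this

lemma X_pr (i : Fin 3) : Prime (X i : MvPowerSeries (Fin 3) k) := by
  refine ⟨X_ne i, ?_, ?_⟩
  · intro h
    have := h.map (constantCoeff (σ := Fin 3) (R := k))
    simp at this
  · intro a b h
    simp only [dvd_iff, map_mul, mul_eq_zero] at *
    exact h

lemma not_dvd {i j : Fin 3} (h : i ≠ j) : ¬ (X i : MvPowerSeries (Fin 3) k) ∣ X j := by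
  rw [dvd_iff, e_ne h]; exact X_ne j

/-- elements with zero constant coefficient -/
lemma mem_max (f : MvPowerSeries (Fin 3) k) (h : constantCoeff f = 0) :
    ∃ a b c, f = X 0 * a + X 1 * b + X 2 * c := by
  obtain ⟨c, hc⟩ := dvd_sub 2 f
  obtain ⟨b, hb⟩ := dvd_sub 1 (e 2 f)
  obtain ⟨a, ha⟩ := dvd_sub 0 (e 1 (e 2 f))
  rw [e_all, h, map_zero] at ha
  refine ⟨a, b, c, ?_⟩
  rw [← ha, ← hb, ← hc]; ring

/-- the key one-variable valuation fact -/
lemma key (A : MvPowerSeries (Fin 3) k) (hA : e 0 (e 2 A) ≠ 0) :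
    ∃ n c p q, X 1 ^ n = c * A + p * X 0 + q * X 2 := by
  have : IsDomain (MvPowerSeries (Fin 3) k) := NoZeroDivisors.to_isDomain _
  obtain ⟨n, u, hu, hB⟩ := WfDvdMonoid.max_power_factor hA (X_pr 1).irreducible
  have h1 : X 1 ^ n * e 0 (e 2 u) = X 1 ^ n * u := by
    rw [← hB]
    have := congrArg (fun t => e 0 (e 2 t)) hB
    simp only [map_mul, map_pow, e_ne (show (2 : Fin 3) ≠ 1 by decide),
      e_ne (show (0 : Fin 3) ≠ 1 by decide)] at this
    rw [← this, e_comm 2 0, e_e, e_e]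
  have h2 : e 0 (e 2 u) = u := mul_left_cancel₀ (pow_ne_zero n (X_ne 1)) h1
  have h3 := e_all u
  rw [e_comm 0 1] at h3
  rw [h2] at h3
  have hc : constantCoeff u ≠ 0 := by
    intro h0
    rw [h0, map_zero] at h3
    exact hu ((dvd_iff _ _).2 h3)
  have hun : IsUnit u := by rw [MvPowerSeries.isUnit_iff_constantCoeff]; exact hc.isUnit
  obtain ⟨v, hv⟩ := hun.exists_right_inv
  obtain ⟨q, hq⟩ := dvd_sub 2 A
  obtain ⟨p, hp⟩ := dvd_sub 0 (e 2 A)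
  refine ⟨n, v, -(v * p), -(v * q), ?_⟩
  have : X 1 ^ n = (X 1 ^ n * u) * v := by rw [mul_assoc, hv, mul_one]
  rw [this, ← hB]
  linear_combination -v * hp - v * hq

lemma depth_aux {R : Type*} [CommRing R] [IsNoetherianRing R] [IsLocalRing R] (a b u : R)
    (ha : a ∈ nonunits R) (hreg : ∀ r, a * r = 0 → r = 0)
    (hb : ∀ r, a ∣ b * r → a ∣ r) (hu : u ≠ 0) (N : ℕ) (p q : R)
    (h : b ^ N = p + q * a) (hp : p * u = 0) : False := by
  have hfin : ∃ m, ¬ a ^ m ∣ u := by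
    by_contra! hc
    apply hu
    have hne : Ideal.span {a} ≠ ⊤ := by
      rw [Ne, Ideal.span_singleton_eq_top]; exact ha
    have := Ideal.iInf_pow_eq_bot_of_isLocalRing _ hne
    rw [← Ideal.mem_bot, ← this, Ideal.mem_iInf]
    intro m
    rw [Ideal.span_singleton_pow, Ideal.mem_span_singleton]
    exact hc m
  have hpow : ∀ m r, a ^ m * r = 0 → r = 0 := by
    intro m
    induction m with
    | zero => intro r; simp
    | succ m ih => intro r hr; apply hreg; apply ih; rw [← hr]; ring
  have hbp : ∀ m r, a ∣ b ^ m * r → a ∣ r := by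
    intro m
    induction m with
    | zero => intro r; simp
    | succ m ih => intro r hr; apply hb; apply ih; rwa [← mul_assoc, ← pow_succ]
  classical
  obtain ⟨m, hm⟩ : ∃ m, Nat.find hfin = m + 1 := by
    rcases hz : Nat.find hfin with _ | m
    · have := Nat.find_spec hfin; rw [hz] at this; simp at this
    · exact ⟨m, rfl⟩
  have hs := Nat.find_spec hfin
  rw [hm] at hs
  have hd : a ^ m ∣ u := by
    by_contra hcon
    have := Nat.find_min' hfin hcon
    omega
  obtain ⟨w, rfl⟩ := hd
  have hpw : p * w = 0 := hpow m _ (by rw [← hp]; ring)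
  have : a ∣ w := hbp N w ⟨q * w, by rw [h]; linear_combination hpw⟩
  exact hs (by rw [pow_succ]; exact mul_dvd_mul_left _ this)

lemma lift_nonunit {T : Type*} [CommRing T] (π : MvPowerSeries (Fin 3) k →+* T)
    (hs : Function.Surjective π) (t : T) (ht : t ∈ nonunits T) :
    ∃ f a b c, π f = t ∧ f = X 0 * a + X 1 * b + X 2 * c := by
  obtain ⟨f, rfl⟩ := hs t
  obtain ⟨a, b, c, h⟩ := mem_max f (by
    by_contra h
    apply ht
    have : IsUnit f := by rw [MvPowerSeries.isUnit_iff_constantCoeff]; exact Ne.isUnit h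
    exact this.map π)
  exact ⟨f, a, b, c, rfl, h⟩

lemma max_min {T : Type*} [CommRing T] [IsLocalRing T] (π : MvPowerSeries (Fin 3) k →+* T)
    (hs : Function.Surjective π) (hx : π (X 0) ^ 2 = 0) (I : Ideal T)
    (hI : I ≤ IsLocalRing.maximalIdeal T) (h1 : π (X 1) ∈ I) (h2 : π (X 2) ∈ I) :
    IsLocalRing.maximalIdeal T ∈ I.minimalPrimes := by
  refine ⟨⟨inferInstance, hI⟩, ?_⟩
  rintro p ⟨hp, hIp⟩ _ t ht
  obtain ⟨f, a, b, c, rfl, rfl⟩ := lift_nonunit π hs t ht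
  have h0 : π (X 0) ∈ p := hp.mem_of_pow_mem 2 (by rw [hx]; exact p.zero_mem)
  simp only [map_add, map_mul]
  exact p.add_mem (p.add_mem (p.mul_mem_right _ h0) (p.mul_mem_right _ (hIp h1)))
    (p.mul_mem_right _ (hIp h2))

lemma X_nonunit {T : Type*} [CommRing T] [Nontrivial T] (π : MvPowerSeries (Fin 3) k →+* T)
    (hs : Function.Surjective π) (f : MvPowerSeries (Fin 3) k) (hf : constantCoeff f = 0) :
    π f ∈ nonunits T := by
  have : IsLocalHom π := Function.Surjective.isLocalHom π hs
  intro h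
  have h2 := (isUnit_of_map_unit π f h).map (constantCoeff (σ := Fin 3) (R := k))
  rw [hf] at h2
  exact not_isUnit_zero h2

lemma moduleDim_self (T : Type*) [CommRing T] : moduleDim T T = ringKrullDim T := by
  unfold moduleDim
  have : Module.annihilator T T = ⊥ := Module.annihilator_eq_bot.2 inferInstance
  rw [this]
  exact ringKrullDim_eq_of_ringEquiv (RingEquiv.quotientBot T)

lemma one_le_depth {T : Type*} [CommRing T] [IsLocalRing T] (t : T)
    (ht : t ∈ nonunits T) (h : ∀ r, t * r = 0 → r = 0) :
    RingTheory.Sequence.IsRegular T [t] := by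
  rw [IsLocalRing.isRegular_iff_isWeaklyRegular_of_subset_maximalIdeal]
  · rw [RingTheory.Sequence.isWeaklyRegular_singleton_iff]
    intro a b hab
    have := h (a - b) (by rw [mul_sub]; exact sub_eq_zero.2 hab)
    exact sub_eq_zero.1 this
  · intro r hr
    simp only [List.mem_singleton] at hr
    rw [hr]; exact ht

lemma depth_ge {T : Type*} [CommRing T] [IsLocalRing T] (t : T)
    (ht : t ∈ nonunits T) (h : ∀ r, t * r = 0 → r = 0) : 1 ≤ moduleDepth T T := by
  apply le_sSup
  exact ⟨[t], by simp, by simpa using ht, one_le_depth t ht h⟩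

lemma depth_le {T : Type*} [CommRing T] [IsNoetherianRing T] [IsLocalRing T]
    (h : ringKrullDim T ≤ 1) : moduleDepth T T ≤ 1 := by
  apply sSup_le
  rintro n ⟨rs, rfl, -, hr⟩
  have h1 := ringKrullDim_add_length_eq_ringKrullDim_of_isRegular rs hr
  have : Nontrivial (T ⧸ Ideal.ofList rs) := by
    rw [Ideal.Quotient.nontrivial_iff]
    intro h
    apply hr.top_ne_smul
    rw [h]; simp
  have h2 : 0 ≤ ringKrullDim (T ⧸ Ideal.ofList rs) := ringKrullDim_nonneg_of_nontrivial
  have h3 : ((rs.length : ℕ∞) : WithBot ℕ∞) ≤ 1 := by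
    refine le_trans ?_ h
    rw [← h1]
    calc ((rs.length : ℕ∞) : WithBot ℕ∞) = 0 + (rs.length : WithBot ℕ∞) := by simp
      _ ≤ _ := by gcongr
  exact_mod_cast h3

lemma CM_aux {T : Type*} [CommRing T] (π : MvPowerSeries (Fin 3) k →+* T)
    (hs : Function.Surjective π) (i j : Fin 3) (hij : (i = 1 ∧ j = 2) ∨ (i = 2 ∧ j = 1))
    (hker : ∀ f, π f = 0 ↔ ∃ a b, f = X 0 ^ 2 * a + X i * b) :
    IsCohenMacaulay T T ∧ ringKrullDim T = 1 := by
  have hi0 : i ≠ 0 := by rcases hij with ⟨rfl, rfl⟩ | ⟨rfl, rfl⟩ <;> decide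
  have hj0 : j ≠ 0 := by rcases hij with ⟨rfl, rfl⟩ | ⟨rfl, rfl⟩ <;> decide
  have hne : i ≠ j := by rcases hij with ⟨rfl, rfl⟩ | ⟨rfl, rfl⟩ <;> decide
  have : Nontrivial T := by
    refine ⟨π 1, 0, ?_⟩
    intro h
    obtain ⟨a, b, hab⟩ := (hker 1).1 h
    have := congrArg (constantCoeff (σ := Fin 3) (R := k)) hab
    simp at this
  have : IsNoetherianRing T := isNoetherianRing_of_surjective _ _ π hs
  have : IsLocalRing T := IsLocalRing.of_surjective' π hs
  have hjn : π (X j) ∈ nonunits T := X_nonunit π hs _ (by simp)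
  have hx : π (X 0) ^ 2 = 0 := by
    rw [← map_pow, hker]; exact ⟨1, 0, by ring⟩
  have hi : π (X i) = 0 := by
    rw [hker]; exact ⟨0, 1, by ring⟩
  have hreg : ∀ r, π (X j) * r = 0 → r = 0 := by
    intro r hr
    obtain ⟨f, rfl⟩ := hs r
    rw [← map_mul, hker] at hr
    obtain ⟨a, b, hab⟩ := hr
    have h1 := congrArg (e i) hab
    simp only [map_mul, map_add, map_pow, e_self, e_ne hi0, e_ne hne, zero_mul, add_zero] at h1
    have h2 : X 0 ^ 2 ∣ e i f := by
      have : X 0 ^ 2 ∣ e i f * X j := ⟨_, by rw [mul_comm]; exact h1⟩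
      exact (X_pr 0).pow_dvd_of_dvd_mul_right 2 (not_dvd hj0.symm) this
    obtain ⟨c, hc⟩ := h2
    obtain ⟨d, hd⟩ := dvd_sub i f
    rw [hker]
    exact ⟨c, d, by linear_combination hc + hd⟩
  have hge := depth_ge _ hjn hreg
  have hmin : IsLocalRing.maximalIdeal T ∈ (Ideal.span {π (X j)}).minimalPrimes := by
    have hjm : π (X j) ∈ Ideal.span {π (X j)} := Ideal.mem_span_singleton_self _
    have him : π (X i) ∈ Ideal.span {π (X j)} := by rw [hi]; exact zero_mem _
    apply max_min π hs hx
    · rw [Ideal.span_singleton_le_iff_mem]; exact hjn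
    · rcases hij with ⟨rfl, rfl⟩ | ⟨rfl, rfl⟩ <;> assumption
    · rcases hij with ⟨rfl, rfl⟩ | ⟨rfl, rfl⟩ <;> assumption
  have hdle : ringKrullDim T ≤ 1 := by
    rw [← IsLocalRing.maximalIdeal_height_eq_ringKrullDim]
    exact_mod_cast Ideal.height_le_one_of_isPrincipal_of_mem_minimalPrimes _ _ hmin
  have hdge : 1 ≤ ringKrullDim T := by
    have h1 := ringKrullDim_add_length_eq_ringKrullDim_of_isRegular _ (one_le_depth _ hjn hreg)
    have : Nontrivial (T ⧸ Ideal.ofList [π (X j)]) := by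
      rw [Ideal.Quotient.nontrivial_iff]
      simpa [Ideal.span_singleton_eq_top] using hjn
    have h2 : 0 ≤ ringKrullDim (T ⧸ Ideal.ofList [π (X j)]) := ringKrullDim_nonneg_of_nontrivial
    rw [← h1]
    calc (1 : WithBot ℕ∞) = 0 + 1 := by simp
      _ ≤ _ := by
        simp only [List.length_singleton, Nat.cast_one]
        gcongr
  have hd := le_antisymm hdle hdge
  refine ⟨?_, hd⟩
  unfold IsCohenMacaulay
  rw [moduleDim_self, hd, le_antisymm (depth_le hdle) hge]
  rfl

lemma dim_ge {T : Type*} [CommRing T] (π : MvPowerSeries (Fin 3) k →+* T)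
    (hs : Function.Surjective π)
    (hker : ∀ f, π f = 0 → X 0 ∣ f) : 2 ≤ ringKrullDim T := by
  have hk : ∀ (g : MvPowerSeries (Fin 3) k →+* MvPowerSeries (Fin 3) k), g (X 0) = 0 →
      ∃ P : PrimeSpectrum T, ∀ f, π f ∈ P.asIdeal ↔ g f = 0 := by
    intro g hg
    have : IsDomain (MvPowerSeries (Fin 3) k) := NoZeroDivisors.to_isDomain _
    have hle : RingHom.ker π ≤ RingHom.ker g := by
      intro f hf
      obtain ⟨c, rfl⟩ := hker f hf
      rw [RingHom.mem_ker, map_mul, hg, zero_mul]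
    refine ⟨⟨RingHom.ker (RingHom.liftOfSurjective π hs ⟨g, hle⟩), RingHom.ker_isPrime _⟩, ?_⟩
    intro f
    rw [RingHom.mem_ker]
    have : (RingHom.liftOfSurjective π hs ⟨g, hle⟩) (π f) = g f :=
      RingHom.liftOfRightInverse_comp_apply _ _ _ _ _
    rw [this]
  obtain ⟨P, hP⟩ := hk (e 0) (e_self 0)
  obtain ⟨Q, hQ⟩ := hk ((e 1).comp (e 0)) (by simp [e_self])
  obtain ⟨M, hM⟩ := hk ((e 2).comp ((e 1).comp (e 0))) (by simp [e_self])
  have hPQ : P < Q := by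
    refine lt_of_le_of_ne ?_ ?_
    · intro t ht
      obtain ⟨f, rfl⟩ := hs t
      rw [hP] at ht
      rw [hQ, RingHom.comp_apply, ht, map_zero]
    · rintro rfl
      have := (hQ (X 1)).2 (by simp [e_self, e_ne (show (0 : Fin 3) ≠ 1 by decide)])
      rw [hP, e_ne (by decide)] at this
      exact X_ne _ this
  have hQM : Q < M := by
    refine lt_of_le_of_ne ?_ ?_
    · intro t ht
      obtain ⟨f, rfl⟩ := hs t
      rw [hQ] at ht
      rw [hM, RingHom.comp_apply, ht, map_zero]
    · rintro rfl
      have := (hM (X 2)).2 (by simp [e_self, e_ne (show (0 : Fin 3) ≠ 2 by decide),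
        e_ne (show (1 : Fin 3) ≠ 2 by decide)])
      rw [hQ, RingHom.comp_apply, e_ne (by decide), e_ne (by decide)] at this
      exact X_ne _ this
  let l : LTSeries (PrimeSpectrum T) :=
    { length := 2
      toFun := ![P, Q, M]
      step := by
        intro i
        fin_cases i
        · exact hPQ
        · exact hQM }
  have := Order.LTSeries.length_le_krullDim l
  exact this

lemma mem_of {f : MvPowerSeries (Fin 3) k} (h : ∃ a b, X 0 * f = X 0 ^ 2 * a + X 0 * (X 1 * X 2) * b) :
    ∃ a b, f = X 0 * a + X 1 * X 2 * b := by
  obtain ⟨a, b, h⟩ := h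
  exact ⟨a, b, mul_left_cancel₀ (X_ne 0) (by rw [h]; ring)⟩

lemma main_aux {T : Type*} [CommRing T] (π : MvPowerSeries (Fin 3) k →+* T)
    (hs : Function.Surjective π)
    (hker : ∀ f, π f = 0 ↔ ∃ a b, f = X 0 ^ 2 * a + X 0 * (X 1 * X 2) * b) :
    IsNoetherianRing T ∧ IsLocalRing T ∧ ringKrullDim T = 2 ∧ moduleDepth T T = 1 ∧
    IsSystemOfParameters T T ![π (X 1), π (X 2)] ∧
    π (X 1) ∉ nonZeroDivisors T ∧ π (X 2) ∉ nonZeroDivisors T := by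
  have : Nontrivial T := by
    refine ⟨π 1, 0, ?_⟩
    intro h
    obtain ⟨a, b, hab⟩ := (hker 1).1 h
    have := congrArg (constantCoeff (σ := Fin 3) (R := k)) hab
    simp at this
  have hN : IsNoetherianRing T := isNoetherianRing_of_surjective _ _ π hs
  have hL : IsLocalRing T := IsLocalRing.of_surjective' π hs
  have hx : π (X 0) ^ 2 = 0 := by
    rw [← map_pow, hker]; exact ⟨1, 0, by ring⟩
  have hxyz : π (X 0) * (π (X 1) * π (X 2)) = 0 := by
    rw [← map_mul, ← map_mul, hker]; exact ⟨0, 1, by ring⟩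
  -- `x y ≠ 0`, `x z ≠ 0`
  have hxy : π (X 0) * π (X 1) ≠ 0 := by
    rw [← map_mul, Ne, hker]
    intro h
    obtain ⟨a, b, hab⟩ := mem_of h
    have := congrArg (fun t => e 0 (e 2 t)) hab
    simp [e_self, e_ne (show (0 : Fin 3) ≠ 1 by decide), e_ne (show (2 : Fin 3) ≠ 1 by decide),
      e_ne (show (2 : Fin 3) ≠ 0 by decide), X_ne] at this
  have hxz : π (X 0) * π (X 2) ≠ 0 := by
    rw [← map_mul, Ne, hker]
    intro h
    obtain ⟨a, b, hab⟩ := mem_of h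
    have := congrArg (fun t => e 0 (e 1 t)) hab
    simp [e_self, e_ne (show (0 : Fin 3) ≠ 2 by decide), e_ne (show (1 : Fin 3) ≠ 2 by decide),
      e_ne (show (1 : Fin 3) ≠ 0 by decide), X_ne] at this
  have hy : π (X 1) ∈ nonunits T := X_nonunit π hs _ (by simp)
  have hz : π (X 2) ∈ nonunits T := X_nonunit π hs _ (by simp)
  have hyz : π (X 1 + X 2) ∈ nonunits T := X_nonunit π hs _ (by simp)
  have hmin : IsLocalRing.maximalIdeal T ∈ (Ideal.span {π (X 1), π (X 2)}).minimalPrimes := by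
    apply max_min π hs hx
    · rw [Ideal.span_le]
      rintro t (rfl | rfl)
      · exact hy
      · exact hz
    · exact Ideal.subset_span (by simp)
    · exact Ideal.subset_span (by simp)
  have hd : ringKrullDim T = 2 := by
    apply le_antisymm
    · rw [← IsLocalRing.maximalIdeal_height_eq_ringKrullDim]
      have h1 := Ideal.height_le_card_of_mem_minimalPrimes_span (by simp) hmin
      have h2 : ((({π (X 1), π (X 2)} : Set T).ncard : ℕ) : ℕ∞) ≤ 2 := by
        have := Set.ncard_insert_le (π (X 1)) {π (X 2)}
        rw [Set.ncard_singleton] at this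
        exact_mod_cast this
      exact WithBot.coe_le_coe.2 (h1.trans h2)
    · apply dim_ge π hs
      intro f hf
      obtain ⟨a, b, rfl⟩ := (hker f).1 hf
      exact ⟨X 0 * a + X 1 * X 2 * b, by ring⟩
  have hreg : ∀ r, π (X 1 + X 2) * r = 0 → r = 0 := by
    intro r hr
    obtain ⟨f, rfl⟩ := hs r
    rw [← map_mul, hker] at hr
    obtain ⟨a, b, hab⟩ := hr
    have h0 : X 0 ∣ (X 1 + X 2) * f := ⟨X 0 * a + X 1 * X 2 * b, by rw [hab]; ring⟩
    have hn1 : ¬ (X 1 : MvPowerSeries (Fin 3) k) ∣ X 1 + X 2 := by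
      rw [dvd_iff, map_add, e_self, e_ne (by decide), zero_add]; exact X_ne _
    have hn2 : ¬ (X 2 : MvPowerSeries (Fin 3) k) ∣ X 1 + X 2 := by
      rw [dvd_iff, map_add, e_self, e_ne (by decide), add_zero]; exact X_ne _
    have hn0 : ¬ (X 0 : MvPowerSeries (Fin 3) k) ∣ X 1 + X 2 := by
      rw [dvd_iff, map_add, e_ne (by decide), e_ne (by decide)]
      intro h
      exact hn1 (h ▸ dvd_zero _)
    obtain ⟨g, rfl⟩ := ((X_pr 0).dvd_or_dvd h0).resolve_left hn0
    obtain ⟨a, b, h1⟩ := mem_of (f := (X 1 + X 2) * g) ⟨a, b, by rw [← hab]; ring⟩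
    have h2 := congrArg (e 0) h1
    simp only [map_mul, map_add, e_self, e_ne (show (0 : Fin 3) ≠ 1 by decide),
      e_ne (show (0 : Fin 3) ≠ 2 by decide), zero_mul, zero_add] at h2
    obtain ⟨h, hh⟩ := ((X_pr 1).dvd_or_dvd (a := X 1 + X 2) (b := e 0 g)
      ⟨X 2 * e 0 b, by rw [h2]; ring⟩).resolve_left hn1
    rw [hh] at h2
    have h3 : (X 1 + X 2) * h = X 2 * e 0 b := mul_left_cancel₀ (X_ne 1) (by
      linear_combination h2)
    obtain ⟨h', rfl⟩ := ((X_pr 2).dvd_or_dvd (a := X 1 + X 2) (b := h)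
      ⟨e 0 b, h3⟩).resolve_left hn2
    obtain ⟨g', hg'⟩ := dvd_sub 0 g
    rw [hker]
    exact ⟨g', h', by linear_combination X 0 * hg' + X 0 * hh⟩
  have hdepth : moduleDepth T T = 1 := by
    refine le_antisymm ?_ (depth_ge _ hyz hreg)
    apply sSup_le
    rintro n ⟨rs, rfl, hnu, hr⟩
    match rs, hnu, hr with
    | [], _, _ => simp
    | [a], _, _ => simp
    | a :: b :: l, hnu, hr =>
      exfalso
      rw [RingTheory.Sequence.isRegular_cons_iff, RingTheory.Sequence.isRegular_cons_iff] at hr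
      obtain ⟨har, hbr, -⟩ := hr
      have ha : a ∈ nonunits T := hnu a (by simp)
      have hb : b ∈ nonunits T := hnu b (by simp)
      have har' : ∀ r, a * r = 0 → r = 0 := fun r hr => har (by
        simpa using hr)
      have hbr' : ∀ r, a ∣ b * r → a ∣ r := by
        intro r hr
        have := (isSMulRegular_quotient_iff_mem_of_smul_mem _ b).1 hbr r (by
          obtain ⟨c, hc⟩ := hr
          rw [Submodule.mem_smul_pointwise_iff_exists]
          exact ⟨c, trivial, hc.symm⟩)
        rw [Submodule.mem_smul_pointwise_iff_exists] at this
        obtain ⟨c, -, hc⟩ := this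
        exact ⟨c, hc.symm⟩
      obtain ⟨A, rfl⟩ := hs a
      have hA : e 0 (e 2 A) ≠ 0 := by
        intro h0
        apply hxy
        apply har'
        obtain ⟨q, hq⟩ := dvd_sub 2 A
        obtain ⟨p, hp⟩ := (dvd_iff _ _).2 h0
        have : A = X 0 * p + X 2 * q := by rw [← hp, ← hq]; ring
        rw [this, map_add, map_mul, map_mul]
        linear_combination (π p * π (X 1)) * hx + π q * hxyz
      obtain ⟨n, c, p, q, hn⟩ := key A hA
      obtain ⟨B, b0, b1, b2, rfl, rfl⟩ := lift_nonunit π hs b hb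
      obtain ⟨d, hdd⟩ := sub_dvd_pow_sub_pow (X 0 * b0 + X 1 * b1 + X 2 * b2) (X 1 * b1) n
      refine depth_aux (π A) _ (π (X 0) * π (X 1)) ha har' hbr' hxy n
        (π ((X 0 * b0 + X 2 * b2) * d + b1 ^ n * (p * X 0 + q * X 2))) (π (b1 ^ n * c)) ?_ ?_
      · rw [← map_pow, ← map_mul, ← map_add]
        congr 1
        rw [mul_pow] at hdd
        linear_combination hdd + b1 ^ n * hn
      · simp only [map_add, map_mul]
        linear_combination (π (X 1) * (π b0 * π d + π (b1 ^ n) * π p)) * hx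
          + (π b2 * π d + π (b1 ^ n) * π q) * hxyz
  refine ⟨hN, hL, hd, hdepth, ⟨?_, ?_, ?_⟩, ?_, ?_⟩
  · intro i; fin_cases i
    · exact hy
    · exact hz
  · rw [moduleDim_self, hd]; rfl
  · have hr : Ideal.span (Set.range ![π (X 1), π (X 2)]) • (⊤ : Submodule T T)
        = Ideal.span {π (X 1), π (X 2)} := by
      simp [Set.pair_comm]
    rw [hr]
    have hAr := IsLocalRing.quotient_artinian_of_mem_minimalPrimes_of_isLocalRing _ hmin
    rw [isFiniteLength_iff_isNoetherian_isArtinian]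
    exact ⟨inferInstance,
      isArtinian_of_surjective_algebraMap (Ideal.Quotient.mk_surjective
        (I := Ideal.span {π (X 1), π (X 2)}))⟩
  · intro h
    exact hxz (mem_nonZeroDivisors_iff_right.1 h _ (by linear_combination hxyz))
  · intro h
    exact hxy (mem_nonZeroDivisors_iff_right.1 h _ (by linear_combination hxyz))

end Ex

/-- Let `R = k[[x,y,z]]/(x^2, x y z)`. Then `R` is a two-dimensional
Noetherian local ring of depth one, `y, z` is a system of parameters of `R`, both `y` and `z`
are zero-divisors, and both `R/(y)` and `R/(z)` are Cohen-Macaulay rings of dimension one. -/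
theorem example_two_dim_depth_one (k : Type*) [Field k]
    (y z : ExampleRingXYZ k)
    (hy : y = Ideal.Quotient.mk _ (MvPowerSeries.X 1))
    (hz : z = Ideal.Quotient.mk _ (MvPowerSeries.X 2)) :
    IsNoetherianRing (ExampleRingXYZ k) ∧
    IsLocalRing (ExampleRingXYZ k) ∧
    ringKrullDim (ExampleRingXYZ k) = 2 ∧
    moduleDepth (ExampleRingXYZ k) (ExampleRingXYZ k) = 1 ∧
    IsSystemOfParameters (ExampleRingXYZ k) (ExampleRingXYZ k) ![y, z] ∧
    y ∉ nonZeroDivisors (ExampleRingXYZ k) ∧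
    z ∉ nonZeroDivisors (ExampleRingXYZ k) ∧
    IsCohenMacaulay (ExampleRingXYZ k ⧸ Ideal.span {y})
      (ExampleRingXYZ k ⧸ Ideal.span {y}) ∧
    ringKrullDim (ExampleRingXYZ k ⧸ Ideal.span {y}) = 1 ∧
    IsCohenMacaulay (ExampleRingXYZ k ⧸ Ideal.span {z})
      (ExampleRingXYZ k ⧸ Ideal.span {z}) ∧
    ringKrullDim (ExampleRingXYZ k ⧸ Ideal.span {z}) = 1 := by
  have hk0 : ∀ f : MvPowerSeries (Fin 3) k, (Ideal.Quotient.mk _ f : ExampleRingXYZ k) = 0 ↔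
      ∃ a b, f = MvPowerSeries.X 0 ^ 2 * a
        + MvPowerSeries.X 0 * (MvPowerSeries.X 1 * MvPowerSeries.X 2) * b := by
    intro f
    rw [Ideal.Quotient.eq_zero_iff_mem, Ideal.mem_span_pair]
    constructor
    · rintro ⟨a, b, h⟩; exact ⟨a, b, by rw [← h]; ring⟩
    · rintro ⟨a, b, h⟩; exact ⟨a, b, by rw [h]; ring⟩
  obtain ⟨h1, h2, h3, h4, h5, h6, h7⟩ := Ex.main_aux (T := ExampleRingXYZ k)
    (Ideal.Quotient.mk _) Ideal.Quotient.mk_surjective hk0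
  have hq : ∀ i j : Fin 3, ((i = 1 ∧ j = 2) ∨ (i = 2 ∧ j = 1)) →
      ∀ w : ExampleRingXYZ k, w = Ideal.Quotient.mk _ (MvPowerSeries.X i) →
      IsCohenMacaulay (ExampleRingXYZ k ⧸ Ideal.span {w}) (ExampleRingXYZ k ⧸ Ideal.span {w}) ∧
      ringKrullDim (ExampleRingXYZ k ⧸ Ideal.span {w}) = 1 := by
    intro i j hij w hw
    refine Ex.CM_aux ((Ideal.Quotient.mk (Ideal.span {w})).comp (Ideal.Quotient.mk _))
      (Ideal.Quotient.mk_surjective.comp Ideal.Quotient.mk_surjective) i j hij ?_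
    intro f
    rw [RingHom.comp_apply, Ideal.Quotient.eq_zero_iff_mem, Ideal.mem_span_singleton]
    constructor
    · rintro ⟨c, hc⟩
      obtain ⟨g, rfl⟩ := Ideal.Quotient.mk_surjective c
      rw [hw, ← map_mul, ← sub_eq_zero, ← map_sub, hk0] at hc
      obtain ⟨a, b, h⟩ := hc
      rcases hij with ⟨rfl, rfl⟩ | ⟨rfl, rfl⟩
      · exact ⟨a, g + MvPowerSeries.X 0 * MvPowerSeries.X 2 * b, by linear_combination h⟩
      · exact ⟨a, g + MvPowerSeries.X 0 * MvPowerSeries.X 1 * b, by linear_combination h⟩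
    · rintro ⟨a, b, h⟩
      refine ⟨Ideal.Quotient.mk _ b, ?_⟩
      rw [hw, ← map_mul, ← sub_eq_zero, ← map_sub, hk0]
      exact ⟨a, 0, by rw [h]; ring⟩
  obtain ⟨h8, h9⟩ := hq 1 2 (by simp) y hy
  obtain ⟨h10, h11⟩ := hq 2 1 (by simp) z hz
  subst hy hz
  exact ⟨h1, h2, h3, h4, h5, h6, h7, h8, h9, h10, h11⟩
end
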